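/- Let 𝒱 be a finite type, B a type (of blocks), f : 𝒱 → Option (List B), and S a finset of 𝒱. For a list Λ over B, define V_Λ to be the finset of validators v ∈ S such that f v = some L for some list L having Λ as a prefix. If Λ and Λ' are conflicting lists (neither a prefix of the other) and 2·|V_Λ| > |S|, then 2·|V_{Λ'}| ≤ |S|. -/

import Mathlib

open Classical in
/-- Uniqueness for grade-0 outputs: a validator cannot see majority quorums for two
conflicting logs. -/
theorem uniqueness_grade_zero {𝒱 B : Type*} [Fintype 𝒱] [DecidableEq 𝒱]
    (f : 𝒱 → Option (List B)) (S : Finset 𝒱) (Λ Λ' : List B)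
    (hconf : ¬ Λ <+: Λ' ∧ ¬ Λ' <+: Λ)
    (h : 2 * (S.filter fun v => ∃ L, f v = some L ∧ Λ <+: L).card > S.card) :
    2 * (S.filter fun v => ∃ L, f v = some L ∧ Λ' <+: L).card ≤ S.card := by
  have hdisj : Disjoint (S.filter fun v => ∃ L, f v = some L ∧ Λ <+: L)
      (S.filter fun v => ∃ L, f v = some L ∧ Λ' <+: L) := by
    refine Finset.disjoint_filter.2 ?_
    rintro v - ⟨L, hL, hΛ⟩ ⟨L', hL', hΛ'⟩
    obtain rfl : L = L' := Option.some.inj (hL.symm.trans hL')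
    exact (List.prefix_or_prefix_of_prefix hΛ hΛ').elim hconf.1 hconf.2
  have hcard := Finset.card_le_card
    (Finset.union_subset (Finset.filter_subset (fun v => ∃ L, f v = some L ∧ Λ <+: L) S)
      (Finset.filter_subset (fun v => ∃ L, f v = some L ∧ Λ' <+: L) S))
  rw [Finset.card_union_of_disjoint hdisj] at hcard
  omega
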